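/- Let p ∈ (0,1) and let {X_n, n≥1} be a φ-mixing sequence of random variables with common marginal distribution function F. Let ε > 0 be such that δ_1 = F(ξ_p + ε) − p > 0 and δ_2 = p − F(ξ_p − ε) > 0. Then for any 0 < β < 1, with m = ⌈n^β⌉, P(|ξ_{p,n} − ξ_p| > ε) ≤ 4e C_1 exp{−n [min(δ_1, δ_2)]² / (2 C_2 (2 + n^β max(δ_1, δ_2)))}, where C_1 = exp{2e n^{1−β} φ(m)} and C_2 = 4[1 + 4 Σ_{i=1}^{2m} φ^{1/2}(i)]. -/

import Mathlib

open MeasureTheory Filter Set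

/-- The σ-algebra generated by the random variables `X i` for `i ∈ S`. -/
noncomputable def sigmaGen {Ω : Type*} (X : ℕ → Ω → ℝ) (S : Set ℕ) : MeasurableSpace Ω :=
  ⨆ i ∈ S, MeasurableSpace.comap (X i) inferInstance

/-- The φ-mixing coefficients of the sequence `X` with respect to the measure `μ`:
`φ(n) = sup_{k ≥ 1} sup { |P(B|A) - P(B)| : A ∈ σ(X_i, 1 ≤ i ≤ k), P(A) > 0,
B ∈ σ(X_i, i ≥ k + n) }`. -/
noncomputable def phiCoef {Ω : Type*} [MeasurableSpace Ω] (X : ℕ → Ω → ℝ)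
    (μ : Measure Ω) (n : ℕ) : ℝ :=
  sSup {r : ℝ | ∃ k : ℕ, 1 ≤ k ∧ ∃ A B : Set Ω,
    MeasurableSet[sigmaGen X {i | 1 ≤ i ∧ i ≤ k}] A ∧
    MeasurableSet[sigmaGen X {i | k + n ≤ i}] B ∧
    0 < μ A ∧
    r = |(μ (A ∩ B)).toReal / (μ A).toReal - (μ B).toReal|}

/-- The empirical distribution function `F_n(x) = n⁻¹ ∑_{i=1}^n I(X_i ≤ x)`. -/
noncomputable def empDF {Ω : Type*} (X : ℕ → Ω → ℝ) (n : ℕ) (ω : Ω) (x : ℝ) : ℝ :=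
  (n : ℝ)⁻¹ * ∑ i ∈ Finset.Icc 1 n, (if X i ω ≤ x then (1 : ℝ) else 0)

/-- The `p`-th quantile `F⁻¹(p) = inf {x : F(x) ≥ p}` of a distribution function `F`. -/
noncomputable def quantile (F : ℝ → ℝ) (p : ℝ) : ℝ :=
  sInf {x : ℝ | p ≤ F x}

/-- The sample `p`-th quantile `ξ_{p,n} = F_n⁻¹(p) = inf {x : F_n(x) ≥ p}`. -/
noncomputable def sampleQuantile {Ω : Type*} (X : ℕ → Ω → ℝ) (n : ℕ) (ω : Ω) (p : ℝ) : ℝ :=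
  sInf {x : ℝ | p ≤ empDF X n ω x}

section MixingCoefficient

variable {Ω : Type*} [mΩ : MeasurableSpace Ω] {μ : Measure Ω} [IsProbabilityMeasure μ]
  {X : ℕ → Ω → ℝ}

theorem sigmaGen_le (hX : ∀ i, Measurable (X i)) (S : Set ℕ) : sigmaGen X S ≤ mΩ :=
  iSup₂_le fun i _ => (hX i).comap_le

omit mΩ in
theorem comap_le_sigmaGen {S : Set ℕ} {i : ℕ} (hi : i ∈ S) :
    MeasurableSpace.comap (X i) inferInstance ≤ sigmaGen X S :=
  le_iSup₂_of_le i hi le_rfl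

theorem abs_cond_sub_le_one (A B : Set Ω) :
    |(μ (A ∩ B)).toReal / (μ A).toReal - (μ B).toReal| ≤ 1 := by
  have h1 : (μ (A ∩ B)).toReal ≤ (μ A).toReal := measureReal_mono inter_subset_left
  have h2 : (μ (A ∩ B)).toReal / (μ A).toReal ≤ 1 := div_le_one_of_le₀ h1 ENNReal.toReal_nonneg
  have h3 : 0 ≤ (μ (A ∩ B)).toReal / (μ A).toReal := by positivity
  have h4 : (μ B).toReal ≤ 1 := measureReal_le_one
  have h5 : 0 ≤ (μ B).toReal := ENNReal.toReal_nonneg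
  rw [abs_le]
  constructor <;> linarith

omit [IsProbabilityMeasure μ] in
theorem phiCoef_nonneg (n : ℕ) : 0 ≤ phiCoef X μ n := by
  apply Real.sSup_nonneg
  rintro r ⟨k, -, A, B, -, -, -, rfl⟩
  exact abs_nonneg _

theorem phiCoef_le_one (n : ℕ) : phiCoef X μ n ≤ 1 := by
  apply Real.sSup_le _ zero_le_one
  rintro r ⟨k, -, A, B, -, -, -, rfl⟩
  exact abs_cond_sub_le_one A B

theorem phiCoef_le_sqrt (n : ℕ) : phiCoef X μ n ≤ Real.sqrt (phiCoef X μ n) :=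
  Real.le_sqrt_of_sq_le (by
    nlinarith [phiCoef_nonneg (X := X) (μ := μ) n, phiCoef_le_one (X := X) (μ := μ) n])

theorem toReal_measure_inter_le_phiCoef {k g : ℕ} (hk : 1 ≤ k) {A B : Set Ω}
    (hA : MeasurableSet[sigmaGen X {i | 1 ≤ i ∧ i ≤ k}] A)
    (hB : MeasurableSet[sigmaGen X {i | k + g ≤ i}] B) :
    (μ (A ∩ B)).toReal ≤ (μ A).toReal * ((μ B).toReal + phiCoef X μ g) := by
  rcases eq_or_ne (μ A) 0 with h0 | h0
  · rw [measure_mono_null inter_subset_left h0, h0]; simp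
  have hbdd : |(μ (A ∩ B)).toReal / (μ A).toReal - (μ B).toReal| ≤ phiCoef X μ g := by
    refine le_csSup ⟨1, ?_⟩ ⟨k, hk, A, B, hA, hB, pos_iff_ne_zero.2 h0, rfl⟩
    rintro r ⟨k, -, A, B, -, -, -, rfl⟩
    exact abs_cond_sub_le_one A B
  have hpos : 0 < (μ A).toReal := ENNReal.toReal_pos h0 (measure_ne_top _ _)
  have := (abs_le.1 hbdd).2
  rw [sub_le_iff_le_add, div_le_iff₀ hpos] at this
  linarith

theorem measure_inter_le_phiCoef {k g : ℕ} (hk : 1 ≤ k) {A B : Set Ω}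
    (hA : MeasurableSet[sigmaGen X {i | 1 ≤ i ∧ i ≤ k}] A)
    (hB : MeasurableSet[sigmaGen X {i | k + g ≤ i}] B) :
    μ (A ∩ B) ≤ μ A * (μ B + ENNReal.ofReal (phiCoef X μ g)) := by
  rw [← ENNReal.toReal_le_toReal (measure_ne_top _ _)
    (ENNReal.mul_ne_top (measure_ne_top _ _) (by simp)), ENNReal.toReal_mul,
    ENNReal.toReal_add (measure_ne_top _ _) (by simp), ENNReal.toReal_ofReal (phiCoef_nonneg g)]
  exact toReal_measure_inter_le_phiCoef hk hA hB

theorem setLIntegral_le_phiCoef (hX : ∀ i, Measurable (X i)) {k g : ℕ} (hk : 1 ≤ k) {A : Set Ω}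
    (hA : MeasurableSet[sigmaGen X {i | 1 ≤ i ∧ i ≤ k}] A) {V : Ω → ℝ}
    (hV : Measurable[sigmaGen X {i | k + g ≤ i}] V) (hV0 : 0 ≤ V) {M : ℝ} (hVM : ∀ ω, V ω ≤ M) :
    ∫⁻ ω in A, ENNReal.ofReal (V ω) ∂μ ≤
      μ A * ((∫⁻ ω, ENNReal.ofReal (V ω) ∂μ) + ENNReal.ofReal (phiCoef X μ g * M)) := by
  have hV' : Measurable V := hV.mono (sigmaGen_le hX _) le_rfl
  have hA' : MeasurableSet A := sigmaGen_le hX _ _ hA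
  rw [lintegral_eq_lintegral_meas_lt _ (.of_forall hV0) hV'.aemeasurable,
    lintegral_eq_lintegral_meas_lt _ (.of_forall hV0) hV'.aemeasurable]
  have hM : ENNReal.ofReal (phiCoef X μ g * M) =
      ∫⁻ t in Ioi (0 : ℝ), (Iio M).indicator (fun _ => ENNReal.ofReal (phiCoef X μ g)) t := by
    rw [lintegral_indicator measurableSet_Iio, setLIntegral_const,
      Measure.restrict_apply measurableSet_Iio, inter_comm, Ioi_inter_Iio, Real.volume_Ioo, sub_zero,
      ENNReal.ofReal_mul (phiCoef_nonneg g)]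
  have hmeas : Measurable fun t : ℝ =>
      (Iio M).indicator (fun _ => ENNReal.ofReal (phiCoef X μ g)) t :=
    measurable_const.indicator measurableSet_Iio
  rw [hM, ← lintegral_add_right _ hmeas, ← lintegral_const_mul' _ _ (measure_ne_top _ _)]
  refine lintegral_mono fun t => ?_
  have hB : MeasurableSet[sigmaGen X {i | k + g ≤ i}] {ω | t < V ω} := hV measurableSet_Ioi
  rw [Measure.restrict_apply' hA', inter_comm]
  by_cases ht : t < M
  · simpa [ht] using measure_inter_le_phiCoef hk hA hB
  · have : {ω | t < V ω} = ∅ := by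
      ext ω; simpa using (hVM ω).trans (not_lt.1 ht)
    simp [this]

theorem lintegral_mul_le_phiCoef (hX : ∀ i, Measurable (X i)) {k g : ℕ} (hk : 1 ≤ k)
    {U : Ω → ENNReal} (hU : Measurable[sigmaGen X {i | 1 ≤ i ∧ i ≤ k}] U) {V : Ω → ℝ}
    (hV : Measurable[sigmaGen X {i | k + g ≤ i}] V) (hV0 : 0 ≤ V) {M : ℝ} (hVM : ∀ ω, V ω ≤ M) :
    ∫⁻ ω, U ω * ENNReal.ofReal (V ω) ∂μ ≤ (∫⁻ ω, U ω ∂μ) *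
      ((∫⁻ ω, ENNReal.ofReal (V ω) ∂μ) + ENNReal.ofReal (phiCoef X μ g * M)) := by
  have hle := sigmaGen_le hX {i | 1 ≤ i ∧ i ≤ k}
  have hV' : Measurable V := hV.mono (sigmaGen_le hX _) le_rfl
  set c := (∫⁻ ω, ENNReal.ofReal (V ω) ∂μ) + ENNReal.ofReal (phiCoef X μ g * M)
  have hdom : (μ.withDensity fun ω => ENNReal.ofReal (V ω)).trim hle ≤ c • μ.trim hle := by
    refine Measure.le_iff.2 fun A hA => ?_
    rw [trim_measurableSet_eq hle hA, withDensity_apply _ (hle _ hA), Measure.smul_apply,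
      trim_measurableSet_eq hle hA, smul_eq_mul, mul_comm]
    exact setLIntegral_le_phiCoef hX hk hA hV hV0 hVM
  calc ∫⁻ ω, U ω * ENNReal.ofReal (V ω) ∂μ
      = ∫⁻ ω, U ω ∂(μ.withDensity fun ω => ENNReal.ofReal (V ω)) := by
        rw [lintegral_withDensity_eq_lintegral_mul _ hV'.ennreal_ofReal (hU.mono hle le_rfl)]
        simp only [Pi.mul_apply, mul_comm]
    _ = ∫⁻ ω, U ω ∂((μ.withDensity fun ω => ENNReal.ofReal (V ω)).trim hle) :=
        (lintegral_trim hle hU).symm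
    _ ≤ ∫⁻ ω, U ω ∂(c • μ.trim hle) := lintegral_mono' hdom le_rfl
    _ = (∫⁻ ω, U ω ∂μ) * c := by
        rw [lintegral_smul_measure, lintegral_trim hle hU, smul_eq_mul, mul_comm]

end MixingCoefficient

/-- `W i` is a centred function of `X i`, bounded by `1`, with variance at most `1 / 4`, whose
covariances are controlled by the φ-mixing coefficients of `X`. -/
structure IsPhiCentred {Ω : Type*} [MeasurableSpace Ω] (X : ℕ → Ω → ℝ) (μ : Measure Ω)
    (W : ℕ → Ω → ℝ) : Prop where
  measurable : ∀ i, 1 ≤ i → Measurable[MeasurableSpace.comap (X i) inferInstance] (W i)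
  abs_le_one : ∀ i, 1 ≤ i → ∀ ω, |W i ω| ≤ 1
  integral_eq_zero : ∀ i, 1 ≤ i → ∫ ω, W i ω ∂μ = 0
  integral_sq_le : ∀ i, 1 ≤ i → ∫ ω, W i ω ^ 2 ∂μ ≤ 1 / 4
  integral_mul_le : ∀ i j, 1 ≤ i → i < j → ∫ ω, W i ω * W j ω ∂μ ≤ phiCoef X μ (j - i)

namespace IsPhiCentred

variable {Ω : Type*} [mΩ : MeasurableSpace Ω] {μ : Measure Ω} [IsProbabilityMeasure μ]
  {X W : ℕ → Ω → ℝ}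

omit [IsProbabilityMeasure μ] in
theorem measurable_sum (hW : IsPhiCentred X μ W) {S : Set ℕ} {s : Finset ℕ} {f : ℕ → ℕ}
    (h1 : ∀ r ∈ s, 1 ≤ f r) (hS : ∀ r ∈ s, f r ∈ S) :
    Measurable[sigmaGen X S] fun ω => ∑ r ∈ s, W (f r) ω :=
  @Finset.measurable_fun_sum _ _ _ _ _ _ (sigmaGen X S) _ _ fun r hr =>
    (hW.measurable _ (h1 r hr)).mono (comap_le_sigmaGen (hS r hr)) le_rfl

omit [IsProbabilityMeasure μ] in
theorem measurable' (hX : ∀ i, Measurable (X i)) (hW : IsPhiCentred X μ W) {i : ℕ} (hi : 1 ≤ i) :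
    Measurable (W i) :=
  (hW.measurable i hi).mono (hX i).comap_le le_rfl

omit [IsProbabilityMeasure μ] in
theorem abs_sum_le (hW : IsPhiCentred X μ W) {a : ℕ} (ha : 1 ≤ a) (k : ℕ) (ω : Ω) :
    |∑ r ∈ Finset.range k, W (a + r) ω| ≤ k :=
  (Finset.abs_sum_le_sum_abs _ _).trans <| by
    simpa using Finset.sum_le_sum fun r (_ : r ∈ Finset.range k) =>
      hW.abs_le_one (a + r) (by omega) ω

theorem integrable (hX : ∀ i, Measurable (X i)) (hW : IsPhiCentred X μ W) {i : ℕ} (hi : 1 ≤ i) :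
    Integrable (W i) μ :=
  .of_bound (hW.measurable' hX hi).aestronglyMeasurable 1 (.of_forall (hW.abs_le_one i hi))

theorem integrable_mul (hX : ∀ i, Measurable (X i)) (hW : IsPhiCentred X μ W) {i j : ℕ}
    (hi : 1 ≤ i) (hj : 1 ≤ j) : Integrable (fun ω => W i ω * W j ω) μ :=
  (hW.integrable hX hj).bdd_mul (hW.measurable' hX hi).aestronglyMeasurable
    (.of_forall (hW.abs_le_one i hi))

theorem integral_sum_sq_le (hX : ∀ i, Measurable (X i)) (hW : IsPhiCentred X μ W)
    {a : ℕ} (ha : 1 ≤ a) {Φ : ℝ} {m : ℕ}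
    (hΦ : ∀ k ≤ m, ∑ r ∈ Finset.range k, phiCoef X μ (r + 1) ≤ Φ) {k : ℕ} (hk : k ≤ m) :
    ∫ ω, (∑ r ∈ Finset.range k, W (a + r) ω) ^ 2 ∂μ ≤ k * (1 / 4 + 2 * Φ) := by
  induction k with
  | zero => simp
  | succ k ih =>
    have hmeas : Measurable fun ω => ∑ r ∈ Finset.range k, W (a + r) ω :=
      Finset.measurable_fun_sum _ fun r _ => hW.measurable' hX (by omega)
    have hi1 : Integrable (fun ω => (∑ r ∈ Finset.range k, W (a + r) ω) ^ 2) μ :=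
      .of_bound (hmeas.pow_const 2).aestronglyMeasurable ((k : ℝ) ^ 2) (.of_forall fun ω => by
        simpa using pow_le_pow_left₀ (abs_nonneg _) (hW.abs_sum_le ha k ω) 2)
    have hi2 : ∀ r ∈ Finset.range k, Integrable (fun ω => W (a + r) ω * W (a + k) ω) μ :=
      fun r _ => hW.integrable_mul hX (by omega) (by omega)
    have hi3 : Integrable (fun ω => W (a + k) ω ^ 2) μ := by
      simpa only [sq] using hW.integrable_mul hX (i := a + k) (by omega) (by omega)
    have hcross : ∫ ω, ∑ r ∈ Finset.range k, W (a + r) ω * W (a + k) ω ∂μ ≤ Φ := by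
      rw [integral_finsetSum _ hi2]
      calc ∑ r ∈ Finset.range k, ∫ ω, W (a + r) ω * W (a + k) ω ∂μ
          ≤ ∑ r ∈ Finset.range k, phiCoef X μ (k - 1 - r + 1) := by
            refine Finset.sum_le_sum fun r hr => ?_
            have hr := Finset.mem_range.1 hr
            have := hW.integral_mul_le (a + r) (a + k) (by omega) (by omega)
            rwa [show a + k - (a + r) = k - 1 - r + 1 by omega] at this
        _ = ∑ r ∈ Finset.range k, phiCoef X μ (r + 1) :=
            Finset.sum_range_reflect (fun r => phiCoef X μ (r + 1)) k
        _ ≤ Φ := hΦ k (by omega)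
    have hexp : ∀ ω, (∑ r ∈ Finset.range (k + 1), W (a + r) ω) ^ 2 =
        (∑ r ∈ Finset.range k, W (a + r) ω) ^ 2 +
          2 * (∑ r ∈ Finset.range k, W (a + r) ω * W (a + k) ω) + W (a + k) ω ^ 2 := by
      intro ω
      rw [Finset.sum_range_succ, ← Finset.sum_mul]
      ring
    simp only [hexp]
    rw [integral_add (hi1.fun_add ((integrable_finsetSum _ hi2).const_mul 2)) hi3,
      integral_add hi1 ((integrable_finsetSum _ hi2).const_mul 2), integral_const_mul]
    have h4 := hW.integral_sq_le (a + k) (by omega)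
    have h5 := ih (by omega)
    push_cast
    linarith

theorem lintegral_exp_block_le (hX : ∀ i, Measurable (X i)) (hW : IsPhiCentred X μ W)
    {a : ℕ} (ha : 1 ≤ a) {Φ : ℝ} {m : ℕ}
    (hΦ : ∀ k ≤ m, ∑ r ∈ Finset.range k, phiCoef X μ (r + 1) ≤ Φ)
    {t : ℝ} (ht : 0 ≤ t) (htm : t * m ≤ 1) :
    ∫⁻ ω, ENNReal.ofReal (Real.exp (t * ∑ r ∈ Finset.range m, W (a + r) ω)) ∂μ ≤
      ENNReal.ofReal (Real.exp (t ^ 2 * (m * (1 / 4 + 2 * Φ)))) := by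
  set Y : Ω → ℝ := fun ω => ∑ r ∈ Finset.range m, W (a + r) ω with hY
  have hYm : Measurable Y :=
    Finset.measurable_fun_sum _ fun r _ => hW.measurable' hX (by omega)
  have hYb : ∀ ω, |Y ω| ≤ m := hW.abs_sum_le ha m
  have htY : ∀ ω, |t * Y ω| ≤ 1 := fun ω => by
    rw [abs_mul, abs_of_nonneg ht]
    exact (mul_le_mul_of_nonneg_left (hYb ω) ht).trans htm
  have hi1 : Integrable Y μ := .of_bound hYm.aestronglyMeasurable m (.of_forall hYb)
  have hi2 : Integrable (fun ω => Y ω ^ 2) μ :=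
    .of_bound (hYm.pow_const 2).aestronglyMeasurable ((m : ℝ) ^ 2) (.of_forall fun ω => by
      simpa using pow_le_pow_left₀ (abs_nonneg _) (hYb ω) 2)
  have hY0 : ∫ ω, Y ω ∂μ = 0 := by
    rw [hY, integral_finsetSum _ fun r _ => hW.integrable hX (by omega)]
    exact Finset.sum_eq_zero fun r _ => hW.integral_eq_zero _ (by omega)
  have hiexp : Integrable (fun ω => Real.exp (t * Y ω)) μ :=
    .of_bound (hYm.const_mul t).exp.aestronglyMeasurable (Real.exp 1) (.of_forall fun ω => by
      simpa using (abs_le.1 (htY ω)).2)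
  have hq : Integrable (fun ω => 1 + t * Y ω + t ^ 2 * Y ω ^ 2) μ :=
    ((integrable_const 1).add (hi1.const_mul t)).add (hi2.const_mul _)
  rw [← ofReal_integral_eq_lintegral_ofReal hiexp (.of_forall fun ω => (Real.exp_pos _).le)]
  refine ENNReal.ofReal_le_ofReal ?_
  calc ∫ ω, Real.exp (t * Y ω) ∂μ ≤ ∫ ω, (1 + t * Y ω + t ^ 2 * Y ω ^ 2) ∂μ := by
        refine integral_mono hiexp hq fun ω => ?_
        have := (abs_le.1 (Real.abs_exp_sub_one_sub_id_le (htY ω))).2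
        simp only
        linarith [mul_pow t (Y ω) 2]
    _ = t ^ 2 * ∫ ω, Y ω ^ 2 ∂μ + 1 := by
        rw [integral_add ((integrable_const 1).fun_add (hi1.const_mul t)) (hi2.const_mul _),
          integral_add (integrable_const 1) (hi1.const_mul t), integral_const_mul,
          integral_const_mul, hY0]
        simp [add_comm]
    _ ≤ t ^ 2 * (m * (1 / 4 + 2 * Φ)) + 1 := by
        gcongr
        exact hW.integral_sum_sq_le hX ha hΦ le_rfl
    _ ≤ _ := Real.add_one_le_exp _

/-- Exponential moments of a sum of `K + 1` blocks of length `m`, separated by gaps of length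
`m`. -/
theorem lintegral_exp_blocks_le (hX : ∀ i, Measurable (X i)) (hW : IsPhiCentred X μ W)
    {a : ℕ} (ha : 1 ≤ a) {Φ : ℝ} {m : ℕ} (hm : 1 ≤ m)
    (hΦ : ∀ k ≤ m, ∑ r ∈ Finset.range k, phiCoef X μ (r + 1) ≤ Φ)
    {t : ℝ} (ht : 0 ≤ t) (htm : t * m ≤ 1) (K : ℕ) :
    ∫⁻ ω, ENNReal.ofReal (Real.exp (t * ∑ j ∈ Finset.range (K + 1),
        ∑ r ∈ Finset.range m, W (a + 2 * m * j + r) ω)) ∂μ ≤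
      ENNReal.ofReal (Real.exp ((K + 1) * (t ^ 2 * (m * (1 / 4 + 2 * Φ))) +
        K * (Real.exp 1 * phiCoef X μ m))) := by
  have hv0 : 0 ≤ t ^ 2 * (m * (1 / 4 + 2 * Φ)) := by
    have : 0 ≤ Φ := by simpa using hΦ 0 (Nat.zero_le _)
    positivity
  set v := t ^ 2 * (m * (1 / 4 + 2 * Φ)) with hv
  induction K with
  | zero => simpa [hv] using hW.lintegral_exp_block_le hX ha hΦ ht htm
  | succ K ih =>
    have hk : 1 ≤ a + 2 * m * (K + 1) - m := by
      have : 2 * m * (K + 1) = 2 * m * K + 2 * m := by ring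
      omega
    have hsplit : a + 2 * m * (K + 1) - m + m = a + 2 * m * (K + 1) := by
      have : 2 * m * (K + 1) = 2 * m * K + 2 * m := by ring
      omega
    have hU : Measurable[sigmaGen X {i | 1 ≤ i ∧ i ≤ a + 2 * m * (K + 1) - m}] fun ω =>
        ENNReal.ofReal (Real.exp (t * ∑ j ∈ Finset.range (K + 1),
          ∑ r ∈ Finset.range m, W (a + 2 * m * j + r) ω)) := by
      refine ENNReal.measurable_ofReal.comp (Real.measurable_exp.comp (Measurable.const_mul ?_ t))
      refine @Finset.measurable_fun_sum _ _ _ _ _ _ (sigmaGen X _) _ _ fun j hj => ?_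
      refine hW.measurable_sum (f := fun r => a + 2 * m * j + r) (fun r _ => by omega) ?_
      intro r hr
      have hr := Finset.mem_range.1 hr
      have hj : 2 * m * (j + 1) ≤ 2 * m * (K + 1) :=
        Nat.mul_le_mul_left _ (Finset.mem_range.1 hj)
      have : 2 * m * (j + 1) = 2 * m * j + 2 * m := by ring
      constructor <;> omega
    have hV : Measurable[sigmaGen X {i | a + 2 * m * (K + 1) - m + m ≤ i}] fun ω =>
        Real.exp (t * ∑ r ∈ Finset.range m, W (a + 2 * m * (K + 1) + r) ω) := by
      refine Real.measurable_exp.comp (Measurable.const_mul ?_ t)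
      refine hW.measurable_sum (f := fun r => a + 2 * m * (K + 1) + r) (fun r _ => by omega) ?_
      intro r _
      simp only [hsplit, mem_ofPred_eq]
      omega
    have hVb : ∀ ω, Real.exp (t * ∑ r ∈ Finset.range m, W (a + 2 * m * (K + 1) + r) ω) ≤
        Real.exp 1 := fun ω => by
      refine Real.exp_le_exp.2 (le_trans ?_ htm)
      exact mul_le_mul_of_nonneg_left (abs_le.1 (hW.abs_sum_le (by omega) m ω)).2 ht
    have hmix := lintegral_mul_le_phiCoef (μ := μ) hX hk hU hV (fun ω => (Real.exp_pos _).le) hVb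
    have hblock := hW.lintegral_exp_block_le hX (a := a + 2 * m * (K + 1)) (by omega) hΦ ht htm
    rw [← hv] at hblock
    have hφ : 0 ≤ phiCoef X μ m * Real.exp 1 :=
      mul_nonneg (phiCoef_nonneg m) (Real.exp_pos 1).le
    simp only [Finset.sum_range_succ _ (K + 1), mul_add t, Real.exp_add (t * _),
      ENNReal.ofReal_mul (Real.exp_pos (t * _)).le]
    refine hmix.trans ((mul_le_mul' ih (add_le_add hblock le_rfl)).trans ?_)
    rw [← ENNReal.ofReal_add (Real.exp_pos _).le hφ, ← ENNReal.ofReal_mul (Real.exp_pos _).le]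
    refine ENNReal.ofReal_le_ofReal ?_
    have hstep : Real.exp v + phiCoef X μ m * Real.exp 1 ≤
        Real.exp (v + Real.exp 1 * phiCoef X μ m) := by
      rw [Real.exp_add]
      nlinarith [Real.one_le_exp hv0, Real.add_one_le_exp (Real.exp 1 * phiCoef X μ m),
        Real.exp_pos v]
    calc _ ≤ _ := mul_le_mul_of_nonneg_left hstep (Real.exp_pos _).le
      _ = _ := by rw [← Real.exp_add]; congr 1; push_cast; ring

end IsPhiCentred

theorem sum_blocks_add_sum_blocks (f : ℕ → ℝ) (m L : ℕ) :
    (∑ j ∈ Finset.range L, ∑ r ∈ Finset.range m, f (1 + 2 * m * j + r)) +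
      ∑ j ∈ Finset.range L, ∑ r ∈ Finset.range m, f (1 + m + 2 * m * j + r) =
    ∑ i ∈ Finset.range (2 * m * L), f (1 + i) := by
  induction L with
  | zero => simp
  | succ L ih =>
    rw [Finset.sum_range_succ, Finset.sum_range_succ, add_add_add_comm, ih,
      show 2 * m * (L + 1) = 2 * m * L + m + m by ring, Finset.sum_range_add, Finset.sum_range_add,
      add_assoc]
    simp only [← add_assoc, show 1 + m + 2 * m * L = 1 + 2 * m * L + m by ring]

theorem sum_range_truncate (f : ℕ → ℝ) {n N : ℕ} (h : n ≤ N) :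
    ∑ i ∈ Finset.range N, (if 1 + i ≤ n then f (1 + i) else 0) = ∑ i ∈ Finset.Icc 1 n, f i := by
  rw [← Finset.sum_filter, show (Finset.range N).filter (fun i => 1 + i ≤ n) = Finset.range n by
    ext i; simp; omega, Finset.range_eq_Ico, Finset.sum_Ico_add (fun i => f i)]
  congr 1

namespace IsPhiCentred

variable {Ω : Type*} [mΩ : MeasurableSpace Ω] {μ : Measure Ω} [IsProbabilityMeasure μ]
  {X W : ℕ → Ω → ℝ}

omit [IsProbabilityMeasure μ] in
theorem neg (hW : IsPhiCentred X μ W) : IsPhiCentred X μ fun i ω => -W i ω where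
  measurable i hi := Measurable.neg (hW.measurable i hi)
  abs_le_one i hi ω := by simpa using hW.abs_le_one i hi ω
  integral_eq_zero i hi := by simpa [integral_neg] using hW.integral_eq_zero i hi
  integral_sq_le i hi := by simpa using hW.integral_sq_le i hi
  integral_mul_le i j hi hij := by simpa using hW.integral_mul_le i j hi hij

omit [IsProbabilityMeasure μ] in
theorem truncate (hW : IsPhiCentred X μ W) (n : ℕ) :
    IsPhiCentred X μ fun i ω => if i ≤ n then W i ω else 0 where
  measurable i hi := by
    by_cases h : i ≤ n
    · simpa [h] using hW.measurable i hi
    · simp [h]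
  abs_le_one i hi ω := by
    by_cases h : i ≤ n
    · simpa [h] using hW.abs_le_one i hi ω
    · simp [h]
  integral_eq_zero i hi := by
    by_cases h : i ≤ n
    · simpa [h] using hW.integral_eq_zero i hi
    · simp [h]
  integral_sq_le i hi := by
    by_cases h : i ≤ n
    · simpa [h] using hW.integral_sq_le i hi
    · simp [h]
  integral_mul_le i j hi hij := by
    by_cases h : j ≤ n
    · simpa [h, hij.le.trans h] using hW.integral_mul_le i j hi hij
    · simpa [h] using phiCoef_nonneg (X := X) (μ := μ) (j - i)

theorem lintegral_exp_sum_le (hX : ∀ i, Measurable (X i)) (hW : IsPhiCentred X μ W)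
    {Φ : ℝ} {m : ℕ} (hm : 1 ≤ m)
    (hΦ : ∀ k ≤ m, ∑ r ∈ Finset.range k, phiCoef X μ (r + 1) ≤ Φ)
    {t : ℝ} (ht : 0 ≤ t) (htm : 2 * t * m ≤ 1) {n K : ℕ} (hn : n ≤ 2 * m * (K + 1)) :
    ∫⁻ ω, ENNReal.ofReal (Real.exp (t * ∑ i ∈ Finset.Icc 1 n, W i ω)) ∂μ ≤
      ENNReal.ofReal (Real.exp ((K + 1) * ((2 * t) ^ 2 * (m * (1 / 4 + 2 * Φ))) +
        K * (Real.exp 1 * phiCoef X μ m))) := by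
  have hWn := hW.truncate n
  have ho := hWn.lintegral_exp_blocks_le hX le_rfl hm hΦ (by positivity) htm K
  have he := hWn.lintegral_exp_blocks_le hX (a := 1 + m) (by omega) hm hΦ (by positivity) htm K
  set B := ENNReal.ofReal (Real.exp ((K + 1) * ((2 * t) ^ 2 * (m * (1 / 4 + 2 * Φ))) +
        K * (Real.exp 1 * phiCoef X μ m)))
  set S : ℕ → Ω → ℝ := fun a ω => ∑ j ∈ Finset.range (K + 1),
    ∑ r ∈ Finset.range m, if a + 2 * m * j + r ≤ n then W (a + 2 * m * j + r) ω else 0 with hS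
  have hsum : ∀ ω, ∑ i ∈ Finset.Icc 1 n, W i ω = S 1 ω + S (1 + m) ω := fun ω => by
    rw [hS, ← sum_range_truncate (fun i => W i ω) hn]
    exact (sum_blocks_add_sum_blocks (fun i => if i ≤ n then W i ω else 0) m (K + 1)).symm
  have hmeas : Measurable (S 1) :=
    Finset.measurable_fun_sum _ fun j _ => Finset.measurable_fun_sum _ fun r _ =>
      hWn.measurable' hX (by omega)
  have hle : ∀ ω, ENNReal.ofReal (Real.exp (t * ∑ i ∈ Finset.Icc 1 n, W i ω)) ≤
      2⁻¹ * ENNReal.ofReal (Real.exp (2 * t * S 1 ω)) +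
        2⁻¹ * ENNReal.ofReal (Real.exp (2 * t * S (1 + m) ω)) := fun ω => by
    have h2 : (2⁻¹ : ENNReal) = ENNReal.ofReal 2⁻¹ := by
      rw [ENNReal.ofReal_inv_of_pos two_pos, ENNReal.ofReal_ofNat]
    rw [h2, ← ENNReal.ofReal_mul (by norm_num), ← ENNReal.ofReal_mul (by norm_num),
      ← ENNReal.ofReal_add (by positivity) (by positivity), hsum, mul_add, Real.exp_add]
    refine ENNReal.ofReal_le_ofReal ?_
    rw [show 2 * t * S 1 ω = t * S 1 ω + t * S 1 ω by ring,
      show 2 * t * S (1 + m) ω = t * S (1 + m) ω + t * S (1 + m) ω by ring,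
      Real.exp_add, Real.exp_add]
    nlinarith [sq_nonneg (Real.exp (t * S 1 ω) - Real.exp (t * S (1 + m) ω))]
  calc _ ≤ ∫⁻ ω, (2⁻¹ * ENNReal.ofReal (Real.exp (2 * t * S 1 ω)) +
        2⁻¹ * ENNReal.ofReal (Real.exp (2 * t * S (1 + m) ω))) ∂μ := lintegral_mono hle
    _ = 2⁻¹ * ∫⁻ ω, ENNReal.ofReal (Real.exp (2 * t * S 1 ω)) ∂μ +
        2⁻¹ * ∫⁻ ω, ENNReal.ofReal (Real.exp (2 * t * S (1 + m) ω)) ∂μ := by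
      rw [lintegral_add_left ((hmeas.const_mul _).exp.ennreal_ofReal.const_mul _),
        lintegral_const_mul' _ _ (by simp), lintegral_const_mul' _ _ (by simp)]
    _ ≤ 2⁻¹ * B + 2⁻¹ * B := by gcongr
    _ = B := by rw [← add_mul, ENNReal.inv_two_add_inv_two, one_mul]

/-- Bernstein's inequality for φ-mixing sequences. -/
theorem measure_sum_ge_le (hX : ∀ i, Measurable (X i)) (hW : IsPhiCentred X μ W)
    {β : ℝ} (hβ : 0 < β ∧ β < 1) {n : ℕ} (hn : 1 ≤ n) {m : ℕ} (hm : m = ⌊(n : ℝ) ^ β⌋₊)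
    {C2 : ℝ} (hC2 : C2 = 4 * (1 + 4 * ∑ i ∈ Finset.Icc 1 (2 * m), Real.sqrt (phiCoef X μ i)))
    {δ : ℝ} (hδ : 0 < δ) :
    (μ {ω | n * δ ≤ ∑ i ∈ Finset.Icc 1 n, W i ω}).toReal ≤
      Real.exp (2 * Real.exp 1 * (n : ℝ) ^ (1 - β) * phiCoef X μ m) *
        Real.exp (-(n * δ ^ 2) / (2 * C2 * (2 + (n : ℝ) ^ β * δ))) := by
  have hn1 : (1 : ℝ) ≤ n := by exact_mod_cast hn
  have hnβ : 1 ≤ (n : ℝ) ^ β := Real.one_le_rpow hn1 hβ.1.le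
  have hm1 : 1 ≤ m := hm ▸ Nat.one_le_floor_iff _ |>.2 hnβ
  have hmle : (m : ℝ) ≤ (n : ℝ) ^ β := hm ▸ Nat.floor_le (by positivity)
  have hmge : (n : ℝ) ^ β ≤ 2 * m := by
    have h1 : (n : ℝ) ^ β < m + 1 := hm ▸ Nat.lt_floor_add_one _
    have h2 : (1 : ℝ) ≤ m := by exact_mod_cast hm1
    linarith
  have hmn : (m : ℝ) ≤ n := hmle.trans (by
    simpa using Real.rpow_le_rpow_of_exponent_le hn1 hβ.2.le)
  set Φ := ∑ i ∈ Finset.Icc 1 (2 * m), Real.sqrt (phiCoef X μ i) with hΦdef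
  have hΦ0 : 0 ≤ Φ := Finset.sum_nonneg fun _ _ => Real.sqrt_nonneg _
  have hΦ : ∀ k ≤ m, ∑ r ∈ Finset.range k, phiCoef X μ (r + 1) ≤ Φ := fun k hk => by
    calc ∑ r ∈ Finset.range k, phiCoef X μ (r + 1)
        ≤ ∑ r ∈ Finset.range k, Real.sqrt (phiCoef X μ (r + 1)) :=
          Finset.sum_le_sum fun r _ => phiCoef_le_sqrt _
      _ = ∑ i ∈ Finset.Icc 1 k, Real.sqrt (phiCoef X μ i) := by
          rw [Finset.range_eq_Ico, Finset.sum_Ico_add' (fun i => Real.sqrt (phiCoef X μ i))]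
          congr 1
      _ ≤ Φ := Finset.sum_le_sum_of_subset_of_nonneg (Finset.Icc_subset_Icc le_rfl (by omega))
          fun _ _ _ => Real.sqrt_nonneg _
  have hC2pos : 4 ≤ C2 := by rw [hC2]; linarith
  set D := 2 + (n : ℝ) ^ β * δ with hD
  have hD2 : 2 ≤ D := by rw [hD]; nlinarith
  set t := δ / (C2 * D) with ht
  have ht0 : 0 < t := by positivity
  have htm : 2 * t * m ≤ 1 := by
    have h1 : t * (C2 * D) = δ := by rw [ht]; field_simp
    have h2 : t * C2 * (n : ℝ) ^ β ≤ 1 := by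
      rw [ht, div_mul_eq_mul_div, div_mul_eq_mul_div, div_le_one (by positivity)]
      nlinarith
    refine le_trans ?_ h2
    exact mul_le_mul (by nlinarith) hmle (by positivity) (by positivity)
  set K := n / (2 * m) with hK
  have hKn : n ≤ 2 * m * (K + 1) := (Nat.lt_mul_div_succ n (by omega)).le
  have hKm : (K : ℝ) * (2 * m) ≤ n := by exact_mod_cast Nat.div_mul_le_self n (2 * m)
  have hlint := hW.lintegral_exp_sum_le hX hm1 hΦ ht0.le htm hKn
  set B := (K + 1) * ((2 * t) ^ 2 * (m * (1 / 4 + 2 * Φ))) + K * (Real.exp 1 * phiCoef X μ m)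
    with hB
  have hmarkov : (μ {ω | n * δ ≤ ∑ i ∈ Finset.Icc 1 n, W i ω}).toReal ≤
      Real.exp (B - t * (n * δ)) := by
    have hmeas : Measurable fun ω => ∑ i ∈ Finset.Icc 1 n, W i ω :=
      Finset.measurable_fun_sum _ fun i hi => hW.measurable' hX (Finset.mem_Icc.1 hi).1
    have h1 := (mul_meas_ge_le_lintegral (μ := μ) (hmeas.const_mul t).exp.ennreal_ofReal
      (ENNReal.ofReal (Real.exp (t * (n * δ))))).trans hlint
    have h2 : {ω | n * δ ≤ ∑ i ∈ Finset.Icc 1 n, W i ω} ⊆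
        {ω | ENNReal.ofReal (Real.exp (t * (n * δ))) ≤
          ENNReal.ofReal (Real.exp (t * ∑ i ∈ Finset.Icc 1 n, W i ω))} := fun ω hω =>
      ENNReal.ofReal_le_ofReal (Real.exp_le_exp.2 (mul_le_mul_of_nonneg_left hω ht0.le))
    have h3 := (mul_le_mul' le_rfl (measure_mono h2)).trans h1
    have h4 := ENNReal.toReal_mono ENNReal.ofReal_ne_top h3
    rw [ENNReal.toReal_mul, ENNReal.toReal_ofReal (Real.exp_pos _).le,
      ENNReal.toReal_ofReal (Real.exp_pos _).le] at h4
    rwa [Real.exp_sub, le_div_iff₀' (Real.exp_pos _)]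
  refine hmarkov.trans ?_
  rw [← Real.exp_add, Real.exp_le_exp]
  have hvar : (K + 1) * ((2 * t) ^ 2 * (m * (1 / 4 + 2 * Φ))) ≤ t ^ 2 * C2 * n := by
    have h1 : ((K : ℝ) + 1) * m ≤ 2 * n := by linarith
    have h2 : 1 / 4 + 2 * Φ ≤ C2 / 8 := by rw [hC2]; linarith
    calc (K + 1) * ((2 * t) ^ 2 * (m * (1 / 4 + 2 * Φ)))
        = 4 * t ^ 2 * (((K + 1) * m) * (1 / 4 + 2 * Φ)) := by ring
      _ ≤ 4 * t ^ 2 * ((2 * n) * (C2 / 8)) := by gcongr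
      _ = t ^ 2 * C2 * n := by ring
  have hmixing : K * (Real.exp 1 * phiCoef X μ m) ≤
      2 * Real.exp 1 * (n : ℝ) ^ (1 - β) * phiCoef X μ m := by
    have h1 : (K : ℝ) ≤ (n : ℝ) ^ (1 - β) := by
      rw [Real.rpow_sub (by linarith), Real.rpow_one, le_div_iff₀ (by positivity)]
      exact (mul_le_mul_of_nonneg_left hmge (by positivity)).trans hKm
    have h2 : 0 ≤ Real.exp 1 * phiCoef X μ m := mul_nonneg (Real.exp_pos 1).le (phiCoef_nonneg m)
    have h3 : 0 ≤ (n : ℝ) ^ (1 - β) := by positivity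
    nlinarith
  have hopt : t ^ 2 * C2 * n - t * (n * δ) ≤ -(n * δ ^ 2) / (2 * C2 * D) := by
    have h1 : t ^ 2 * C2 * n - t * (n * δ) - -(n * δ ^ 2) / (2 * C2 * D) =
        n * δ ^ 2 / (2 * C2 * D ^ 2) * (2 - D) := by
      rw [ht]; field_simp; ring
    have h2 : 0 ≤ n * δ ^ 2 / (2 * C2 * D ^ 2) := by positivity
    nlinarith
  rw [hB]
  linarith

end IsPhiCentred

theorem isPhiCentred_indicator {Ω : Type*} [MeasurableSpace Ω] {μ : Measure Ω}
    [IsProbabilityMeasure μ] {X : ℕ → Ω → ℝ} (hX : ∀ i, Measurable (X i)) {x q : ℝ}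
    (hq : ∀ i, 1 ≤ i → q = (μ {ω | X i ω ≤ x}).toReal) :
    IsPhiCentred X μ fun i ω => (if X i ω ≤ x then (1 : ℝ) else 0) - q := by
  have hS : ∀ i, MeasurableSet {ω | X i ω ≤ x} := fun i => hX i measurableSet_Iic
  have hind : ∀ i ω, (if X i ω ≤ x then (1 : ℝ) else 0) =
      {ω | X i ω ≤ x}.indicator 1 ω := fun i ω => by simp [indicator]
  have hint : ∀ S : Set Ω, MeasurableSet S → Integrable (fun ω => S.indicator (1 : Ω → ℝ) ω) μ :=
    fun S h => (integrable_const 1).indicator h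
  have hq0 : 0 ≤ q := hq 1 le_rfl ▸ ENNReal.toReal_nonneg
  have hq1 : q ≤ 1 := hq 1 le_rfl ▸ measureReal_le_one
  have hmul : ∀ i j, 1 ≤ i → 1 ≤ j →
      ∫ ω, ((if X i ω ≤ x then (1 : ℝ) else 0) - q) * ((if X j ω ≤ x then (1 : ℝ) else 0) - q) ∂μ =
        (μ ({ω | X i ω ≤ x} ∩ {ω | X j ω ≤ x})).toReal - q ^ 2 := fun i j hi hj => by
    have hexp : ∀ ω, ((if X i ω ≤ x then (1 : ℝ) else 0) - q) *
        ((if X j ω ≤ x then (1 : ℝ) else 0) - q) =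
        ({ω | X i ω ≤ x} ∩ {ω | X j ω ≤ x}).indicator 1 ω -
          q * {ω | X i ω ≤ x}.indicator 1 ω - q * {ω | X j ω ≤ x}.indicator 1 ω + q ^ 2 :=
      fun ω => by
        rw [hind, hind, inter_indicator_one, Pi.mul_apply]
        ring
    have hi1 := hint _ ((hS i).inter (hS j))
    have hi2 := (hint _ (hS i)).const_mul q
    have hi3 := (hint _ (hS j)).const_mul q
    have hi12 : Integrable (fun ω => ({ω | X i ω ≤ x} ∩ {ω | X j ω ≤ x}).indicator 1 ω -
        q * {ω | X i ω ≤ x}.indicator 1 ω) μ := hi1.sub hi2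
    have hi123 : Integrable (fun ω => ({ω | X i ω ≤ x} ∩ {ω | X j ω ≤ x}).indicator 1 ω -
        q * {ω | X i ω ≤ x}.indicator 1 ω - q * {ω | X j ω ≤ x}.indicator 1 ω) μ := hi12.sub hi3
    simp only [hexp]
    rw [integral_add hi123 (integrable_const _), integral_sub hi12 hi3,
      integral_sub hi1 hi2, integral_const_mul, integral_const_mul,
      integral_indicator_one ((hS i).inter (hS j)), integral_indicator_one (hS i),
      integral_indicator_one (hS j), measureReal_def, measureReal_def, measureReal_def,
      ← hq i hi, ← hq j hj]
    simp
    ring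
  refine ⟨fun i _ => ?_, fun i _ ω => ?_, fun i hi => ?_, fun i hi => ?_, fun i j hi hij => ?_⟩
  · have : Measurable fun y : ℝ => (if y ≤ x then (1 : ℝ) else 0) - q :=
      (Measurable.ite measurableSet_Iic measurable_const measurable_const).sub_const q
    exact this.comp (comap_measurable (X i))
  · split_ifs <;> rw [abs_le] <;> constructor <;> linarith
  · simp only [hind]
    rw [integral_sub (hint _ (hS i)) (integrable_const _), integral_indicator_one (hS i),
      measureReal_def, ← hq i hi]
    simp
  · simp only [sq]
    rw [hmul i i hi hi, inter_self, ← hq i hi]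
    nlinarith [sq_nonneg (q - 1 / 2)]
  · rw [hmul i j hi (by omega)]
    have hA : MeasurableSet[sigmaGen X {l | 1 ≤ l ∧ l ≤ i}] {ω | X i ω ≤ x} :=
      comap_le_sigmaGen (X := X) (i := i) (show 1 ≤ i ∧ i ≤ i from ⟨hi, le_rfl⟩) _ ⟨Iic x, measurableSet_Iic, rfl⟩
    have hB : MeasurableSet[sigmaGen X {l | i + (j - i) ≤ l}] {ω | X j ω ≤ x} :=
      comap_le_sigmaGen (X := X) (i := j) (show i + (j - i) ≤ j by omega) _
        ⟨Iic x, measurableSet_Iic, rfl⟩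
    have h := toReal_measure_inter_le_phiCoef (μ := μ) hi hA hB
    rw [← hq i hi, ← hq j (by omega)] at h
    nlinarith [phiCoef_nonneg (X := X) (μ := μ) (j - i)]

section SampleQuantile

variable {Ω : Type*} (X : ℕ → Ω → ℝ) {n : ℕ} {ω : Ω} {p x : ℝ}

theorem empDF_mono : Monotone (empDF X n ω) := fun x y hxy => by
  unfold empDF
  gcongr with i
  split_ifs with h1 h2 <;> first | exact le_rfl | exact zero_le_one | exact absurd (h1.trans hxy) h2

theorem sum_indicator_eq_mul_empDF (hn : 1 ≤ n) :
    ∑ i ∈ Finset.Icc 1 n, (if X i ω ≤ x then (1 : ℝ) else 0) = n * empDF X n ω x := by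
  have : (n : ℝ) ≠ 0 := by positivity
  rw [empDF, mul_inv_cancel_left₀ this]

theorem empDF_lt_of_lt_sampleQuantile (hp : 0 < p) (h : x < sampleQuantile X n ω p) :
    empDF X n ω x < p := by
  by_contra! hx
  refine h.not_ge (csInf_le ⟨-∑ i ∈ Finset.Icc 1 n, |X i ω|, fun y hy => ?_⟩ hx)
  by_contra! hlt
  have h0 : empDF X n ω y = 0 := by
    rw [empDF, Finset.sum_eq_zero, mul_zero]
    intro i hi
    have h1 := Finset.single_le_sum (f := fun i => |X i ω|) (fun _ _ => abs_nonneg _) hi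
    have h2 := neg_abs_le (X i ω)
    exact if_neg (by linarith)
  have hy' : p ≤ empDF X n ω y := hy
  linarith

theorem le_empDF_of_sampleQuantile_lt (hn : 1 ≤ n) (hp : p ≤ 1) (h : sampleQuantile X n ω p < x) :
    p ≤ empDF X n ω x := by
  have hne : {x : ℝ | p ≤ empDF X n ω x}.Nonempty := by
    refine ⟨∑ i ∈ Finset.Icc 1 n, |X i ω|, ?_⟩
    have h1 : empDF X n ω (∑ i ∈ Finset.Icc 1 n, |X i ω|) = 1 := by
      have hn0 : (n : ℝ) ≠ 0 := by positivity
      rw [empDF, Finset.sum_congr rfl fun i hi => if_pos ((le_abs_self (X i ω)).trans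
        (Finset.single_le_sum (f := fun i => |X i ω|) (fun _ _ => abs_nonneg _) hi))]
      simp [hn0]
    exact hp.trans h1.ge
  obtain ⟨y, hy, hyx⟩ := exists_lt_of_csInf_lt hne h
  exact le_trans hy (empDF_mono X hyx.le)

end SampleQuantile

/-- **Quantile deviation bound.** For a φ-mixing sequence with common marginal
distribution function `F` and `ε > 0` with `δ₁ = F(ξ_p + ε) - p > 0` and
`δ₂ = p - F(ξ_p - ε) > 0`, for any `0 < β < 1`, with `m = ⌊n^β⌋`,
`P(|ξ_{p,n} - ξ_p| > ε) ≤ 4e C₁ exp{-n min(δ₁,δ₂)² / (2 C₂ (2 + n^β max(δ₁,δ₂)))}`,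
where `C₁ = exp{2e n^{1-β} φ(m)}` and `C₂ = 4[1 + 4 ∑_{i=1}^{2m} φ^{1/2}(i)]`. -/
theorem bahadur_quantile_deviation {Ω : Type*} [MeasurableSpace Ω] (μ : Measure Ω)
    [IsProbabilityMeasure μ]
    (X : ℕ → Ω → ℝ) (hX : ∀ i, Measurable (X i))
    (hanti : Antitone (phiCoef X μ))
    (hmix : Tendsto (phiCoef X μ) atTop (nhds 0))
    (F : ℝ → ℝ) (hF : ∀ i, 1 ≤ i → ∀ x, F x = (μ {ω | X i ω ≤ x}).toReal)
    (p : ℝ) (hp : 0 < p ∧ p < 1)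
    (ε : ℝ) (hε : 0 < ε)
    (δ1 δ2 : ℝ) (hδ1 : δ1 = F (quantile F p + ε) - p) (hδ2 : δ2 = p - F (quantile F p - ε))
    (hδ1pos : 0 < δ1) (hδ2pos : 0 < δ2)
    (β : ℝ) (hβ : 0 < β ∧ β < 1)
    (n : ℕ) (hn : 1 ≤ n)
    (m : ℕ) (hm : m = ⌊(n : ℝ) ^ β⌋₊)
    (C1 : ℝ) (hC1 : C1 = Real.exp (2 * Real.exp 1 * (n : ℝ) ^ (1 - β) * phiCoef X μ m))
    (C2 : ℝ) (hC2 : C2 = 4 * (1 + 4 * ∑ i ∈ Finset.Icc 1 (2 * m), Real.sqrt (phiCoef X μ i))) :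
    (μ {ω | ε < |sampleQuantile X n ω p - quantile F p|}).toReal ≤
      4 * Real.exp 1 * C1 *
        Real.exp (-(n * min δ1 δ2 ^ 2) / (2 * C2 * (2 + (n : ℝ) ^ β * max δ1 δ2))) := by
  have hW1 := (isPhiCentred_indicator hX (hF · · (quantile F p + ε))).neg
  have hW2 := isPhiCentred_indicator hX (hF · · (quantile F p - ε))
  have h1 := hW1.measure_sum_ge_le hX hβ hn hm hC2 hδ1pos
  have h2 := hW2.measure_sum_ge_le hX hβ hn hm hC2 hδ2pos
  rw [← hC1] at h1 h2
  have hn0 : (0 : ℝ) ≤ n := Nat.cast_nonneg n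
  have hsub : {ω | ε < |sampleQuantile X n ω p - quantile F p|} ⊆
      {ω | n * δ1 ≤ ∑ i ∈ Finset.Icc 1 n,
        -((if X i ω ≤ quantile F p + ε then (1 : ℝ) else 0) - F (quantile F p + ε))} ∪
      {ω | n * δ2 ≤ ∑ i ∈ Finset.Icc 1 n,
        ((if X i ω ≤ quantile F p - ε then (1 : ℝ) else 0) - F (quantile F p - ε))} := by
    intro ω hω
    rcases lt_abs.1 (show ε < |sampleQuantile X n ω p - quantile F p| from hω) with h | h
    · left
      have hlt := empDF_lt_of_lt_sampleQuantile X hp.1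
        (show quantile F p + ε < sampleQuantile X n ω p by linarith)
      rw [mem_ofPred_eq, Finset.sum_neg_distrib, Finset.sum_sub_distrib,
        sum_indicator_eq_mul_empDF X hn, hδ1]
      simp only [Finset.sum_const, Nat.card_Icc, add_tsub_cancel_right, nsmul_eq_mul]
      nlinarith
    · right
      have hle := le_empDF_of_sampleQuantile_lt X hn hp.2.le
        (show sampleQuantile X n ω p < quantile F p - ε by linarith)
      rw [mem_ofPred_eq, Finset.sum_sub_distrib, sum_indicator_eq_mul_empDF X hn, hδ2]
      simp only [Finset.sum_const, Nat.card_Icc, add_tsub_cancel_right, nsmul_eq_mul]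
      nlinarith
  have hC2pos : 0 < C2 := by
    have : 0 ≤ ∑ i ∈ Finset.Icc 1 (2 * m), Real.sqrt (phiCoef X μ i) :=
      Finset.sum_nonneg fun _ _ => Real.sqrt_nonneg _
    rw [hC2]
    positivity
  have hC1pos : 0 < C1 := hC1 ▸ Real.exp_pos _
  have hmono : ∀ δ, min δ1 δ2 ≤ δ → δ ≤ max δ1 δ2 →
      Real.exp (-(n * δ ^ 2) / (2 * C2 * (2 + (n : ℝ) ^ β * δ))) ≤
        Real.exp (-(n * min δ1 δ2 ^ 2) / (2 * C2 * (2 + (n : ℝ) ^ β * max δ1 δ2))) := by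
    intro δ hmin hmax
    have hmin0 : 0 < min δ1 δ2 := lt_min hδ1pos hδ2pos
    have hδ0 : 0 < δ := hmin0.trans_le hmin
    rw [Real.exp_le_exp, neg_div, neg_div, neg_le_neg_iff]
    gcongr
  have hunion := (ENNReal.toReal_mono (measure_ne_top _ _)
    (measure_mono (μ := μ) hsub)).trans (measureReal_union_le (μ := μ) _ _)
  have hb1 := mul_le_mul_of_nonneg_left (hmono δ1 (min_le_left _ _) (le_max_left _ _)) hC1pos.le
  have hb2 := mul_le_mul_of_nonneg_left (hmono δ2 (min_le_right _ _) (le_max_right _ _)) hC1pos.le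
  set E := Real.exp (-(n * min δ1 δ2 ^ 2) / (2 * C2 * (2 + (n : ℝ) ^ β * max δ1 δ2)))
  have hE : 0 < C1 * E := mul_pos hC1pos (Real.exp_pos _)
  have he : 1 ≤ Real.exp 1 := Real.one_le_exp zero_le_one
  simp only [measureReal_def] at hunion
  nlinarith
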